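/- Let A be a finite dimensional triangular k-algebra with primitive orthogonal idempotents e_1,…,e_n (so e_i A e_j = 0 for j < i and e_i A e_i ≅ k), and M a triangular A-A-bimodule (e_i M e_j = 0 for j < i). Then for the trivial extension Λ = A ⋉ DM, the Cartan matrix C_Λ satisfies (C_Λ)₊ = C_A and (C_Λ)₋ = C_M, where for a matrix B, B₊ is its strictly-upper part with ones added on the diagonal and B₋ its transpose-lower part as in the paper's decomposition B = B₊ + B₋ᵀ. -/

import Mathlib

open Module MulOpposite

variable (k : Type*) [Field k]

/-- The corner space `e·A·f` of an algebra `A`, as a `k`-submodule. -/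
def corner {A : Type*} [Ring A] [Algebra k A] (e f : A) : Submodule k A :=
  LinearMap.range ((LinearMap.mulLeft k e) ∘ₗ (LinearMap.mulRight k f))

/-- The corner space `e·M·f` of an `A`-`A`-bimodule `M`, as a `k`-submodule. -/
def cornerBimod {A M : Type*} [Ring A] [Algebra k A]
    [AddCommGroup M] [Module k M] [Module A M] [Module Aᵐᵒᵖ M]
    [SMulCommClass A k M] [SMulCommClass Aᵐᵒᵖ k M] (e f : A) : Submodule k M :=
  LinearMap.range
    ((DistribMulAction.toLinearMap k M e) ∘ₗ (DistribMulAction.toLinearMap k M (op f)))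

/-- An idempotent `e` is primitive if it is nonzero and cannot be written as a sum of
two nonzero orthogonal idempotents. -/
def IsPrimitiveIdempotent {A : Type*} [Ring A] (e : A) : Prop :=
  IsIdempotentElem e ∧ e ≠ 0 ∧
    ∀ f g : A, IsIdempotentElem f → IsIdempotentElem g → f * g = 0 → g * f = 0 →
      e = f + g → f = 0 ∨ g = 0

/-- The multiplication of the trivial extension `Λ = A ⋉ DM`:
`(a, μ)(a', μ') = (a a', a·μ' + μ·a')`. -/
def trivExtMul {A M : Type*} [Ring A] [Algebra k A]
    [AddCommGroup M] [Module k M]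
    [Module A M] [Module Aᵐᵒᵖ M] [SMulCommClass A Aᵐᵒᵖ M]
    [SMulCommClass A k M] [SMulCommClass Aᵐᵒᵖ k M]
    (p q : A × Module.Dual k M) : A × Module.Dual k M :=
  (p.1 * q.1,
    q.2 ∘ₗ DistribMulAction.toLinearMap k M (op p.1) +
      p.2 ∘ₗ DistribMulAction.toLinearMap k M q.1)

/-- The upper triangular part `B₊` of `B`, with ones on the diagonal. -/
def upperPart {n : ℕ} {R : Type*} [CommRing R] (B : Matrix (Fin n) (Fin n) R) :
    Matrix (Fin n) (Fin n) R :=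
  Matrix.of fun i j => if i < j then B i j else if i = j then 1 else 0

/-- The lower triangular part `B₋` of `B`. -/
def lowerPart {n : ℕ} {R : Type*} [CommRing R] (B : Matrix (Fin n) (Fin n) R) :
    Matrix (Fin n) (Fin n) R :=
  Matrix.of fun i j => if i < j then B j i else if i = j then B i i - 1 else 0

theorem finrank_submodule_prod {V W : Type*} [AddCommGroup V] [Module k V]
    [AddCommGroup W] [Module k W] [FiniteDimensional k V] [FiniteDimensional k W]
    (p : Submodule k V) (q : Submodule k W) :
    finrank k (p.prod q) = finrank k p + finrank k q := by
  rw [← Module.finrank_prod]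
  exact LinearEquiv.finrank_eq
    { toFun := fun x => (⟨x.1.1, x.2.1⟩, ⟨x.1.2, x.2.2⟩)
      invFun := fun x => ⟨(x.1.1, x.2.1), x.1.2, x.2.2⟩
      map_add' := fun _ _ => rfl
      map_smul' := fun _ _ => rfl
      left_inv := fun _ => rfl
      right_inv := fun _ => rfl }

theorem finrank_trivExt_corner {A M : Type*} [Ring A] [Algebra k A]
    [FiniteDimensional k A]
    [AddCommGroup M] [Module k M] [FiniteDimensional k M]
    [Module A M] [Module Aᵐᵒᵖ M] [SMulCommClass A Aᵐᵒᵖ M]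
    [SMulCommClass A k M] [SMulCommClass Aᵐᵒᵖ k M] (e f : A) :
    finrank k (Submodule.span k
        {y : A × Module.Dual k M |
          ∃ x, y = trivExtMul k (e, 0) (trivExtMul k x (f, 0))}) =
      finrank k (corner k e f) + finrank k (cornerBimod k (M := M) f e) := by
  have h : {y : A × Module.Dual k M |
          ∃ x, y = trivExtMul k (e, 0) (trivExtMul k x (f, 0))} =
      (((corner k e f).prod (LinearMap.range (LinearMap.dualMap
        ((DistribMulAction.toLinearMap k M f) ∘ₗ
          (DistribMulAction.toLinearMap k M (op e))))) :
          Submodule k (A × Module.Dual k M)) : Set (A × Module.Dual k M)) := by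
    ext ⟨a, μ⟩
    constructor
    · rintro ⟨⟨b, ν⟩, h⟩
      rw [h]
      refine ⟨⟨b, ?_⟩, ⟨ν, ?_⟩⟩
      · simp [trivExtMul]
      · ext m
        simp [trivExtMul]
    · rintro ⟨⟨b, hb⟩, ⟨ν, hν⟩⟩
      refine ⟨(b, ν), ?_⟩
      simp only at hb hν
      rw [← hb, ← hν]
      refine Prod.ext ?_ ?_
      · simp [trivExtMul]
      · ext m
        simp [trivExtMul]
  rw [h, Submodule.span_eq, finrank_submodule_prod,
    LinearMap.finrank_range_dualMap_eq_finrank_range]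
  rfl

/-- For a triangular algebra `A` and a triangular bimodule `M`, the Cartan matrix `C_Λ`
of the trivial extension `Λ = A ⋉ DM` satisfies `(C_Λ)₊ = C_A` and `(C_Λ)₋ = C_M`,
where Cartan matrices are given by `(C_X)_{ij} = dim_k e_{n+1−j} X e_{n+1−i}`. -/
theorem cartan_trivExt_parts {n : ℕ} {A M : Type*} [Ring A] [Algebra k A]
    [FiniteDimensional k A]
    [AddCommGroup M] [Module k M] [FiniteDimensional k M]
    [Module A M] [Module Aᵐᵒᵖ M] [SMulCommClass A Aᵐᵒᵖ M]
    [SMulCommClass A k M] [SMulCommClass Aᵐᵒᵖ k M]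
    (e : Fin n → A)
    (hprim : ∀ i, IsPrimitiveIdempotent (e i))
    (horth : ∀ i j, i ≠ j → e i * e j = 0)
    (hsum : (∑ i, e i) = 1)
    (htriA : ∀ i j : Fin n, j < i → ∀ a : A, e i * a * e j = 0)
    (hdiagA : ∀ i, finrank k (corner k (e i) (e i)) = 1)
    (htriM : ∀ i j : Fin n, j < i → ∀ m : M, e i • (op (e j) • m) = 0) :
    let CA : Matrix (Fin n) (Fin n) ℤ :=
      Matrix.of fun i j => (finrank k (corner k (e j.rev) (e i.rev)) : ℤ)
    let CM : Matrix (Fin n) (Fin n) ℤ :=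
      Matrix.of fun i j => (finrank k (cornerBimod k (M := M) (e j.rev) (e i.rev)) : ℤ)
    let CL : Matrix (Fin n) (Fin n) ℤ :=
      Matrix.of fun i j => (finrank k (Submodule.span k
        {y : A × Module.Dual k M |
          ∃ x, y = trivExtMul k (e j.rev, 0) (trivExtMul k x (e i.rev, 0))}) : ℤ)
    upperPart CL = CA ∧ lowerPart CL = CM := by
  intro CA CM CL
  have hCL : ∀ i j, CL i j = CA i j + CM j i := by
    intro i j
    simp only [CL, CA, CM, Matrix.of_apply]
    rw [finrank_trivExt_corner]
    push_cast
    rfl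
  have hA : ∀ i j, j < i → CA i j = 0 := by
    intro i j hij
    have : corner k (e j.rev) (e i.rev) = ⊥ := by
      refine LinearMap.range_eq_bot.2 (LinearMap.ext fun a => ?_)
      simpa [mul_assoc] using htriA j.rev i.rev (Fin.rev_lt_rev.2 hij) a
    simp only [CA, Matrix.of_apply]
    rw [this, finrank_bot, Nat.cast_zero]
  have hM : ∀ i j, j < i → CM i j = 0 := by
    intro i j hij
    have : cornerBimod k (M := M) (e j.rev) (e i.rev) = ⊥ := by
      refine LinearMap.range_eq_bot.2 (LinearMap.ext fun a => ?_)
      exact htriM j.rev i.rev (Fin.rev_lt_rev.2 hij) a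
    simp only [CM, Matrix.of_apply]
    rw [this, finrank_bot, Nat.cast_zero]
  have hD : ∀ i, CA i i = 1 := by
    intro i
    simp only [CA, Matrix.of_apply, hdiagA, Nat.cast_one]
  clear_value CA CM CL
  constructor
  · ext i j
    simp only [upperPart, Matrix.of_apply]
    rcases lt_trichotomy i j with h | h | h
    · rw [if_pos h, hCL, hM j i h, add_zero]
    · subst h
      simp [hD]
    · rw [if_neg h.not_gt, if_neg h.ne', hA i j h]
  · ext i j
    simp only [lowerPart, Matrix.of_apply]
    rcases lt_trichotomy i j with h | h | h
    · rw [if_pos h, hCL, hA j i h, zero_add]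
    · subst h
      simp [hCL, hD]
    · rw [if_neg h.not_gt, if_neg h.ne', hM i j h]
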